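/- arXiv:2401.09431 — 7 statements merged into one kernel-verified Lean document; each statement's English description precedes it below -/
import Mathlib

section
/- Let ψ(u) = (1/2)(u + √(1 + u²)). For all s, t ∈ ℝ, (ψ''(s) − ψ''(t))² ≤ (9/8)·(s − t)²·(ψ''(s)² + ψ''(t)²). -/
theorem Real.cosh_sub_one_le_half_sq_mul_cosh (d : ℝ) :
    Real.cosh d - 1 ≤ d ^ 2 / 2 * Real.cosh d := by
  have h₁ : Real.cosh d * Real.exp (-(d ^ 2 / 2)) ≤ 1 := by
    rw [Real.exp_neg, ← div_eq_mul_inv, div_le_one (Real.exp_pos _)]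
    exact Real.cosh_le_exp_half_sq d
  nlinarith [mul_le_mul_of_nonneg_left (Real.add_one_le_exp (-(d ^ 2 / 2))) (Real.cosh_pos d).le]

theorem Real.sq_exp_sub_exp_le (a b : ℝ) :
    (Real.exp a - Real.exp b) ^ 2 ≤
      (a - b) ^ 2 / 2 * (Real.exp a ^ 2 + Real.exp b ^ 2) := by
  have hprod : Real.exp a * Real.exp b * (2 * Real.cosh (a - b)) =
      Real.exp a ^ 2 + Real.exp b ^ 2 := by
    rw [Real.cosh_eq, neg_sub, Real.exp_sub, Real.exp_sub]
    field_simp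
  have hpos : 0 ≤ 2 * (Real.exp a * Real.exp b) := by positivity
  have hmul := mul_le_mul_of_nonneg_left (Real.cosh_sub_one_le_half_sq_mul_cosh (a - b)) hpos
  rw [← hprod]
  nlinarith

theorem Real.abs_log_one_add_sq_sub_le (s t : ℝ) :
    |Real.log (1 + s ^ 2) - Real.log (1 + t ^ 2)| ≤ |s - t| := by
  have hderiv (u : ℝ) : HasDerivAt (fun x : ℝ ↦ Real.log (1 + x ^ 2)) (2 * u / (1 + u ^ 2)) u := by
    have := ((hasDerivAt_pow 2 u).const_add 1).log (by positivity)
    simpa using this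
  have hbound (u : ℝ) : ‖2 * u / (1 + u ^ 2)‖ ≤ 1 := by
    rw [Real.norm_eq_abs, abs_le, le_div_iff₀ (by positivity), div_le_one (by positivity)]
    constructor <;> nlinarith [sq_nonneg (u - 1), sq_nonneg (u + 1)]
  simpa using convex_univ.norm_image_sub_le_of_norm_hasDerivWithin_le
    (fun u _ ↦ (hderiv u).hasDerivWithinAt) (fun u _ ↦ hbound u) (Set.mem_univ t) (Set.mem_univ s)

/-- For ψ''(u) = (1/2)(1+u²)^{-3/2} and all s, t,
(ψ''(s) − ψ''(t))² ≤ (9/8)·(s−t)²·(ψ''(s)² + ψ''(t)²). -/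
theorem smoothed_hinge_second_deriv_relative_lipschitz
    (ψ'' : ℝ → ℝ) (h : ∀ u : ℝ, ψ'' u = (1/2) * (1 + u^2) ^ (-(3:ℝ)/2))
    (s t : ℝ) :
    (ψ'' s - ψ'' t)^2 ≤ (9/8) * (s - t)^2 * ((ψ'' s)^2 + (ψ'' t)^2) := by
  have hexp (u : ℝ) : ψ'' u = (1/2) * Real.exp (Real.log (1 + u^2) * (-3/2)) := by
    rw [h, Real.rpow_def_of_pos (by positivity)]
  rw [hexp s, hexp t]
  have hlog := sq_le_sq.mpr (Real.abs_log_one_add_sq_sub_le s t)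
  have hdiff := Real.sq_exp_sub_exp_le
    (Real.log (1 + s^2) * (-3/2)) (Real.log (1 + t^2) * (-3/2))
  set x := Real.exp (Real.log (1 + s^2) * (-3/2))
  set y := Real.exp (Real.log (1 + t^2) * (-3/2))
  have hmul := mul_le_mul_of_nonneg_right hlog (by positivity : 0 ≤ x ^ 2 + y ^ 2)
  linarith
end

section
/- Let ψ(u) = (1/2)(u + √(1 + u²)). For every u ∈ ℝ, |ψ'''(u)| / ψ''(u)^{3/2} = 3√2 · |u| · (1 + u²)^{-1/4}, and this quantity tends to +∞ as u → ±∞; hence ψ is not self-concordant (there is no constant C with |ψ'''(u)| ≤ C·ψ''(u)^{3/2} for all u). -/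
open Filter

theorem sqrt_le_sqrt_two_mul_mul_one_add_sq_rpow {x : ℝ} (hx : 1 ≤ x) :
    √x ≤ √2 * x * (1 + x ^ 2) ^ (-(1 : ℝ) / 4) := by
  have hx0 : 0 < x := by linarith
  have hpow : ((2 * x) ^ 2) ^ (-(1 : ℝ) / 4) = (√2 * √x)⁻¹ := by
    rw [← Real.rpow_natCast, ← Real.rpow_mul (by positivity), ← Real.sqrt_mul (by norm_num),
      Real.sqrt_eq_rpow, ← Real.rpow_neg (by positivity)]
    norm_num
  calc √x = √2 * x * ((2 * x) ^ 2) ^ (-(1 : ℝ) / 4) := by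
        rw [hpow]
        have := Real.sqrt_pos.2 hx0
        field_simp
        exact Real.sq_sqrt hx0.le
    _ ≤ √2 * x * (1 + x ^ 2) ^ (-(1 : ℝ) / 4) := by
        gcongr ?_ * ?_
        exact Real.rpow_le_rpow_of_nonpos (by positivity) (by nlinarith) (by norm_num)

theorem tendsto_mul_one_add_sq_rpow_atTop :
    Tendsto (fun x : ℝ => 3 * √2 * x * (1 + x ^ 2) ^ (-(1 : ℝ) / 4)) atTop atTop := by
  refine tendsto_atTop_mono' atTop ?_ Real.tendsto_sqrt_atTop
  filter_upwards [eventually_ge_atTop 1] with x hx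
  nlinarith [sqrt_le_sqrt_two_mul_mul_one_add_sq_rpow hx, Real.sqrt_nonneg x]

theorem abs_div_rpow_three_halves {s : ℝ} (hs : 0 < s) (u : ℝ) :
    |-(3 / 2) * u * s ^ (-(5 : ℝ) / 2)| / ((1 / 2) * s ^ (-(3 : ℝ) / 2)) ^ ((3 : ℝ) / 2)
      = 3 * √2 * |u| * s ^ (-(1 : ℝ) / 4) := by
  have hhalf : ((1 : ℝ) / 2) ^ ((3 : ℝ) / 2) = (2 * √2)⁻¹ := by
    rw [one_div, Real.inv_rpow (by norm_num), Real.sqrt_eq_rpow,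
      ← Real.rpow_one_add' (by norm_num) (by norm_num)]
    norm_num
  have hsplit : s ^ (-(5 : ℝ) / 2) = s ^ (-(1 : ℝ) / 4) * s ^ (-(9 : ℝ) / 4) := by
    rw [← Real.rpow_add hs]
    norm_num
  rw [Real.mul_rpow (by norm_num) (by positivity), ← Real.rpow_mul hs.le, hhalf, abs_mul, abs_mul,
    abs_of_pos (Real.rpow_pos_of_pos hs _), hsplit,
    show -(3 : ℝ) / 2 * (3 / 2) = -9 / 4 by norm_num,
    show |-(3 / 2 : ℝ)| = 3 / 2 by norm_num [abs_of_pos]]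
  have := Real.rpow_pos_of_pos hs (-(9 : ℝ) / 4)
  field_simp

/-- With ψ''(u) = (1/2)(1+u²)^{-3/2} and ψ'''(u) = −(3/2)u(1+u²)^{-5/2},
|ψ'''(u)|/ψ''(u)^{3/2} = 3√2·|u|·(1+u²)^{-1/4}, this tends to +∞ as u → ±∞,
and ψ is not self-concordant: no constant C has |ψ'''(u)| ≤ C·ψ''(u)^{3/2} for all u. -/
theorem smoothed_hinge_not_self_concordant
    (ψ'' ψ''' : ℝ → ℝ)
    (h2 : ∀ u : ℝ, ψ'' u = (1/2) * (1 + u^2) ^ (-(3:ℝ)/2))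
    (h3 : ∀ u : ℝ, ψ''' u = -(3/2) * u * (1 + u^2) ^ (-(5:ℝ)/2)) :
    (∀ u : ℝ, |ψ''' u| / (ψ'' u) ^ ((3:ℝ)/2)
        = 3 * Real.sqrt 2 * |u| * (1 + u^2) ^ (-(1:ℝ)/4)) ∧
    Tendsto (fun u : ℝ => |ψ''' u| / (ψ'' u) ^ ((3:ℝ)/2)) atTop atTop ∧
    Tendsto (fun u : ℝ => |ψ''' u| / (ψ'' u) ^ ((3:ℝ)/2)) atBot atTop ∧
    ¬ ∃ C : ℝ, ∀ u : ℝ, |ψ''' u| ≤ C * (ψ'' u) ^ ((3:ℝ)/2) := by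
  have ratio (u : ℝ) : |ψ''' u| / (ψ'' u) ^ ((3:ℝ)/2)
      = 3 * Real.sqrt 2 * |u| * (1 + u^2) ^ (-(1:ℝ)/4) := by
    rw [h2, h3]
    exact abs_div_rpow_three_halves (by positivity) u
  have tendsto_of_abs {l : Filter ℝ} (hl : Tendsto (fun u : ℝ => |u|) l atTop) :
      Tendsto (fun u : ℝ => |ψ''' u| / (ψ'' u) ^ ((3:ℝ)/2)) l atTop := by
    simpa only [ratio, Function.comp_def, sq_abs] using
      tendsto_mul_one_add_sq_rpow_atTop.comp hl
  have top := tendsto_of_abs tendsto_abs_atTop_atTop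
  refine ⟨ratio, top, tendsto_of_abs tendsto_abs_atBot_atTop, ?_⟩
  rintro ⟨C, hC⟩
  obtain ⟨u, hu⟩ := (top.eventually_gt_atTop C).exists
  have hpos : 0 < ψ'' u := by
    rw [h2]
    positivity
  exact hu.not_ge ((div_le_iff₀ (Real.rpow_pos_of_pos hpos _)).2 (hC u))
end

section
/- Let ψ(u) = (1/2)(u + √(1 + u²)) and let H : ℝ → ℝ be the Heaviside function, H(u) = 1 for u > 0 and H(u) = 0 for u ≤ 0. Then for every u ≠ 0, |ψ'(u) − H(u)| ≤ 1/(4u²). -/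
theorem one_sub_div_sqrt_one_add_sq_nonneg (a : ℝ) :
    0 ≤ 1 - a / Real.sqrt (1 + a ^ 2) := by
  have hs : 0 < Real.sqrt (1 + a ^ 2) := Real.sqrt_pos.2 (by positivity)
  rw [sub_nonneg, div_le_one hs]
  exact Real.le_sqrt_of_sq_le (by linarith)

theorem one_sub_div_sqrt_one_add_sq_le {a : ℝ} (ha : 0 < a) :
    1 - a / Real.sqrt (1 + a ^ 2) ≤ 1 / (2 * a ^ 2) := by
  have hs : 0 < Real.sqrt (1 + a ^ 2) := Real.sqrt_pos.2 (by positivity)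
  have hsq : Real.sqrt (1 + a ^ 2) ^ 2 = 1 + a ^ 2 := Real.sq_sqrt (by positivity)
  have hle : a ≤ Real.sqrt (1 + a ^ 2) := Real.le_sqrt_of_sq_le (by linarith)
  generalize Real.sqrt (1 + a ^ 2) = s at *
  rw [one_sub_div hs.ne', div_le_div_iff₀ hs (by positivity)]
  nlinarith [mul_nonneg ha.le (sq_nonneg (s - a))]

/-- With ψ'(u) = (1/2)(1 + u/√(1+u²)) and H the Heaviside function,
for every u ≠ 0, |ψ'(u) − H(u)| ≤ 1/(4u²). -/
theorem smoothed_hinge_deriv_close_to_heaviside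
    (ψ' H : ℝ → ℝ)
    (h1 : ∀ u : ℝ, ψ' u = (1/2) * (1 + u / Real.sqrt (1 + u^2)))
    (hH : ∀ u : ℝ, H u = if 0 < u then 1 else 0)
    (u : ℝ) (hu : u ≠ 0) :
    |ψ' u - H u| ≤ 1 / (4 * u^2) := by
  have hquarter : 1 / (4 * u ^ 2) = 1 / 2 * (1 / (2 * u ^ 2)) := by
    field_simp
    norm_num
  rw [h1, hH, hquarter]
  rcases hu.lt_or_gt with hneg | hpos
  · have hnonneg := one_sub_div_sqrt_one_add_sq_nonneg (-u)
    have hle := one_sub_div_sqrt_one_add_sq_le (neg_pos.2 hneg)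
    rw [neg_sq, neg_div, sub_neg_eq_add] at hnonneg hle
    rw [if_neg hneg.not_gt, abs_le]
    constructor <;> linarith
  · have hnonneg := one_sub_div_sqrt_one_add_sq_nonneg u
    have hle := one_sub_div_sqrt_one_add_sq_le hpos
    rw [if_pos hpos, abs_le]
    constructor <;> linarith
end

section
/- Let a > 0, μ ≥ 0, b, c ∈ ℝ, and w, d ∈ ℝ^m. Then the line-search objective j(s) = a s² + b s + c + μ‖w + s d‖₁ attains a unique global minimizer s* over the interval [0, ∞), and this minimizer satisfies s* ≤ (|b| + μ‖d‖₁)/(2a). -/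
theorem sum_abs_add_mul_sub_le {ι : Type*} [Fintype ι] (w d : ι → ℝ) {s t : ℝ} (hst : s ≤ t) :
    ∑ i, |w i + s * d i| - ∑ i, |w i + t * d i| ≤ (t - s) * ∑ i, |d i| := by
  rw [← Finset.sum_sub_distrib, Finset.mul_sum]
  refine Finset.sum_le_sum fun i _ => ?_
  calc |w i + s * d i| - |w i + t * d i| ≤ |(w i + s * d i) - (w i + t * d i)| :=
        abs_sub_abs_le_abs_sub _ _
    _ = |(t - s) * d i| := by rw [abs_sub_comm]; congr 1; ring
    _ = (t - s) * |d i| := by rw [abs_mul, abs_of_nonneg (sub_nonneg.2 hst)]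

theorem two_mul_sum_abs_add_midpoint_mul_le {ι : Type*} [Fintype ι] (w d : ι → ℝ) (s t : ℝ) :
    2 * ∑ i, |w i + (s + t) / 2 * d i| ≤ ∑ i, |w i + s * d i| + ∑ i, |w i + t * d i| := by
  rw [← Finset.sum_add_distrib, Finset.mul_sum]
  refine Finset.sum_le_sum fun i _ => ?_
  calc 2 * |w i + (s + t) / 2 * d i| = |2 * (w i + (s + t) / 2 * d i)| := by
        rw [abs_mul, abs_two]
    _ = |(w i + s * d i) + (w i + t * d i)| := by congr 1; ring
    _ ≤ _ := abs_add_le _ _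


/-- For a > 0, μ ≥ 0, the line-search objective
j(s) = as² + bs + c + μ‖w + sd‖₁ attains a unique global minimizer s* over [0, ∞),
and s* ≤ (|b| + μ‖d‖₁)/(2a). -/
theorem line_search_objective_unique_minimizer
    (m : ℕ) (a μ b c : ℝ) (ha : 0 < a) (hμ : 0 ≤ μ) (w d : Fin m → ℝ)
    (j : ℝ → ℝ)
    (hj : ∀ s : ℝ, j s = a * s^2 + b * s + c + μ * ∑ i, |w i + s * d i|) :
    ∃ s₀ ∈ Set.Ici (0:ℝ),
      (∀ t ∈ Set.Ici (0:ℝ), j s₀ ≤ j t) ∧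
      (∀ t ∈ Set.Ici (0:ℝ), (∀ r ∈ Set.Ici (0:ℝ), j t ≤ j r) → t = s₀) ∧
      s₀ ≤ (|b| + μ * ∑ i, |d i|) / (2 * a) := by
  set R := (|b| + μ * ∑ i, |d i|) / (2 * a) with hR
  have hR0 : 0 ≤ R := by positivity
  have hRa : 2 * a * R = |b| + μ * ∑ i, |d i| := by rw [hR]; field_simp
  have hcont : Continuous j := by
    rw [funext hj]
    fun_prop
  have hbeyond : ∀ t, R ≤ t → j R ≤ j t := by
    intro t ht
    rw [hj, hj]
    have h₁ := mul_le_mul_of_nonneg_left (sum_abs_add_mul_sub_le w d ht) hμ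
    have h₂ := mul_le_mul_of_nonneg_right (neg_abs_le b) (sub_nonneg.2 ht)
    have h₃ := congrArg (fun x => (t - R) * x) hRa
    have h₄ : 0 ≤ a * (t - R) ^ 2 := by positivity
    linarith
  obtain ⟨s₀, ⟨hs₀, hs₀R⟩, hmin⟩ :=
    isCompact_Icc.exists_isMinOn (Set.nonempty_Icc.2 hR0) hcont.continuousOn
  have hmin' : ∀ t ∈ Set.Ici (0 : ℝ), j s₀ ≤ j t := by
    intro t ht
    rcases le_total t R with h | h
    · exact hmin ⟨ht, h⟩
    · exact (hmin ⟨hR0, le_rfl⟩).trans (hbeyond t h)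
  refine ⟨s₀, hs₀, hmin', fun t ht htmin => ?_, hs₀R⟩
  have hmid : (s₀ + t) / 2 ∈ Set.Ici (0 : ℝ) := by
    rw [Set.mem_Ici] at ht ⊢
    linarith
  have h₁ := hmin' _ hmid
  have h₂ := htmin _ hmid
  rw [hj, hj] at h₁ h₂
  have h₃ := mul_le_mul_of_nonneg_left (two_mul_sum_abs_add_midpoint_mul_le w d s₀ t) hμ
  have h₄ : a * (t - s₀) ^ 2 ≤ 0 := by linarith
  have h₅ : (t - s₀) ^ 2 ≤ 0 := nonpos_of_mul_nonpos_right h₄ ha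
  exact sub_eq_zero.1 (pow_eq_zero_iff two_ne_zero |>.1 (le_antisymm h₅ (sq_nonneg _)))
end

section
/- Let a > 0, μ ≥ 0, b, c ∈ ℝ, w, d ∈ ℝ^m, and let j(s) = a s² + b s + c + μ‖w + s d‖₁. Suppose 0 ≤ σ₁ < σ₂ are such that for every s ∈ (σ₁, σ₂) and every index i with d_i ≠ 0 one has w_i + s d_i ≠ 0 (so j is differentiable on (σ₁, σ₂) with j'(s) = 2as + b + μ Σ_i sign(w_i + s d_i) d_i). If the right derivative j'(σ₁⁺) < 0 and the left derivative j'(σ₂⁻) > 0, then the unique global minimizer of j is s* = σ₁ − j'(σ₁⁺)/(2a), and σ₁ < s* < σ₂. -/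
/-- An affine function without zeros on an open interval that is positive at one point of it
is nonnegative on the closed interval. -/
theorem affine_nonneg_of_ne_zero_of_pos {w d σ₁ σ₂ p s : ℝ} (hd : d ≠ 0)
    (hnz : ∀ t ∈ Set.Ioo σ₁ σ₂, w + t * d ≠ 0) (hp : p ∈ Set.Ioo σ₁ σ₂)
    (hs : s ∈ Set.Icc σ₁ σ₂) (hpos : 0 < w + p * d) : 0 ≤ w + s * d := by
  by_contra! hneg
  refine hnz (-w / d) ?_ (by field_simp; ring)
  rcases lt_or_gt_of_ne hd with hd | hd
  · exact ⟨hp.1.trans ((lt_div_iff_of_neg hd).2 (by linarith)),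
      ((div_lt_iff_of_neg hd).2 (by linarith)).trans_le hs.2⟩
  · exact ⟨hs.1.trans_lt ((lt_div_iff₀ hd).2 (by linarith)),
      ((div_lt_iff₀ hd).2 (by linarith)).trans hp.2⟩

theorem Real.sign_mul_le_abs (x y : ℝ) : Real.sign x * y ≤ |y| := by
  rcases Real.sign_apply_eq x with h | h | h <;> rw [h]
  · simpa using neg_le_abs y
  · simp
  · simpa using le_abs_self y

/-- On a closed interval whose interior contains no kink, the absolute value of an affine
function is linear, with the sign taken at any interior point. -/
theorem abs_affine_eq_sign_mul {w d σ₁ σ₂ p s : ℝ}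
    (hnz : ∀ t ∈ Set.Ioo σ₁ σ₂, d ≠ 0 → w + t * d ≠ 0) (hp : p ∈ Set.Ioo σ₁ σ₂)
    (hs : s ∈ Set.Icc σ₁ σ₂) : |w + s * d| = Real.sign (w + p * d) * (w + s * d) := by
  by_cases hd : d = 0
  · subst hd
    rcases lt_trichotomy w 0 with h | h | h
    · simp [Real.sign_of_neg h, abs_of_neg h]
    · simp [h]
    · simp [Real.sign_of_pos h, abs_of_pos h]
  · rcases lt_or_gt_of_ne (hnz p hp hd) with h | h
    · have hv : 0 ≤ -w + s * -d :=
        affine_nonneg_of_ne_zero_of_pos (neg_ne_zero.2 hd)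
          (fun t ht h0 => hnz t ht hd (by linarith)) hp hs (by linarith)
      rw [Real.sign_of_neg h, abs_of_nonpos (by linarith)]
      ring
    · rw [Real.sign_of_pos h, one_mul, abs_of_nonneg
        (affine_nonneg_of_ne_zero_of_pos hd (fun t ht => hnz t ht hd) hp hs h)]

theorem hasDerivAt_quadratic (a β γ s : ℝ) :
    HasDerivAt (fun t => a * t ^ 2 + β * t + γ) (2 * a * s + β) s := by
  have h := ((((hasDerivAt_id s).pow 2).const_mul a).add
    ((hasDerivAt_id s).const_mul β)).add_const γ
  exact h.congr_deriv (by simp; ring)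

/-- For a > 0, μ ≥ 0, suppose on (σ₁, σ₂) no kink of
j(s) = as² + bs + c + μ‖w + sd‖₁ occurs (so j is differentiable there with
j'(s) = 2as + b + μ Σᵢ sign(wᵢ + s dᵢ)·dᵢ).  If the right derivative L₁ of j at σ₁
is < 0 and the left derivative L₂ of j at σ₂ is > 0, then s* = σ₁ − L₁/(2a) is the
unique global minimizer of j and σ₁ < s* < σ₂. -/
theorem line_search_objective_interior_minimizer
    (m : ℕ) (a μ b c : ℝ) (ha : 0 < a) (hμ : 0 ≤ μ) (w d : Fin m → ℝ)
    (j : ℝ → ℝ)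
    (hj : ∀ s : ℝ, j s = a * s^2 + b * s + c + μ * ∑ i, |w i + s * d i|)
    (σ₁ σ₂ : ℝ) (hσ₁ : 0 ≤ σ₁) (hσ : σ₁ < σ₂)
    (hnz : ∀ s ∈ Set.Ioo σ₁ σ₂, ∀ i, d i ≠ 0 → w i + s * d i ≠ 0)
    (L₁ L₂ : ℝ)
    (hL₁ : HasDerivWithinAt j L₁ (Set.Ici σ₁) σ₁) (hL₁neg : L₁ < 0)
    (hL₂ : HasDerivWithinAt j L₂ (Set.Iic σ₂) σ₂) (hL₂pos : 0 < L₂) :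
    (∀ s ∈ Set.Ioo σ₁ σ₂,
        HasDerivAt j (2 * a * s + b + μ * ∑ i, Real.sign (w i + s * d i) * d i) s) ∧
    σ₁ < σ₁ - L₁ / (2 * a) ∧ σ₁ - L₁ / (2 * a) < σ₂ ∧
    (∀ s : ℝ, j (σ₁ - L₁ / (2 * a)) ≤ j s) ∧
    (∀ s : ℝ, (∀ t : ℝ, j s ≤ j t) → s = σ₁ - L₁ / (2 * a)) := by
  set β : ℝ → ℝ := fun p => b + μ * ∑ i, Real.sign (w i + p * d i) * d i with hβ
  set γ : ℝ → ℝ := fun p => c + μ * ∑ i, Real.sign (w i + p * d i) * w i with hγ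
  have quad_eq (p s : ℝ) : a * s ^ 2 + β p * s + γ p =
      a * s ^ 2 + b * s + c + μ * ∑ i, Real.sign (w i + p * d i) * (w i + s * d i) := by
    have : ∑ i, Real.sign (w i + p * d i) * (w i + s * d i) =
        ∑ i, Real.sign (w i + p * d i) * w i + (∑ i, Real.sign (w i + p * d i) * d i) * s := by
      rw [Finset.sum_mul, ← Finset.sum_add_distrib]
      exact Finset.sum_congr rfl fun i _ => by ring
    rw [this]
    simp only [hβ, hγ]
    ring
  have quad_le (p s : ℝ) : a * s ^ 2 + β p * s + γ p ≤ j s := by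
    rw [quad_eq, hj]
    gcongr
    exact Real.sign_mul_le_abs _ _
  have eq_quad {p : ℝ} (hp : p ∈ Set.Ioo σ₁ σ₂) {s : ℝ} (hs : s ∈ Set.Icc σ₁ σ₂) :
      j s = a * s ^ 2 + β p * s + γ p := by
    rw [quad_eq, hj]
    congr 2
    exact Finset.sum_congr rfl fun i _ =>
      abs_affine_eq_sign_mul (fun t ht => hnz t ht i) hp hs
  obtain ⟨p, hp⟩ := Set.nonempty_Ioo.2 hσ
  have hderiv₁ : L₁ = 2 * a * σ₁ + β p :=
    (uniqueDiffOn_Icc hσ σ₁ (Set.left_mem_Icc.2 hσ.le)).eq_deriv _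
      (hL₁.mono Set.Icc_subset_Ici_self)
      ((hasDerivAt_quadratic a (β p) (γ p) σ₁).hasDerivWithinAt.congr (fun _ => eq_quad hp)
        (eq_quad hp (Set.left_mem_Icc.2 hσ.le)))
  have hderiv₂ : L₂ = 2 * a * σ₂ + β p :=
    (uniqueDiffOn_Icc hσ σ₂ (Set.right_mem_Icc.2 hσ.le)).eq_deriv _
      (hL₂.mono Set.Icc_subset_Iic_self)
      ((hasDerivAt_quadratic a (β p) (γ p) σ₂).hasDerivWithinAt.congr (fun _ => eq_quad hp)
        (eq_quad hp (Set.right_mem_Icc.2 hσ.le)))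
  obtain ⟨x, hx⟩ : ∃ x, x = σ₁ - L₁ / (2 * a) := ⟨_, rfl⟩
  have hβx : β p = -(2 * a * x) := by
    rw [hx]
    field_simp
    linarith
  rw [← hx]
  have hx₁ : σ₁ < x := by nlinarith
  have hx₂ : x < σ₂ := by nlinarith
  have growth (s : ℝ) : j x + a * (s - x) ^ 2 ≤ j s := by
    refine le_of_eq_of_le ?_ (quad_le p s)
    rw [eq_quad hp ⟨hx₁.le, hx₂.le⟩, hβx]
    ring
  refine ⟨fun s hs => ?_, hx₁, hx₂, fun s => ?_, fun s hs => ?_⟩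
  · rw [add_assoc]
    refine (hasDerivAt_quadratic a (β s) (γ s) s).congr_of_eventuallyEq ?_
    filter_upwards [Icc_mem_nhds hs.1 hs.2] with t ht using eq_quad hs ht
  · nlinarith [growth s, mul_nonneg ha.le (sq_nonneg (s - x))]
  · have hsq : (s - x) ^ 2 ≤ 0 := by
      by_contra! h
      linarith [growth s, hs x, mul_pos ha h]
    exact sub_eq_zero.1 (pow_eq_zero_iff two_ne_zero |>.1 (le_antisymm hsq (sq_nonneg _)))
end

section
/- Given data points (x_i, y_i) ∈ ℝ^m × {−1, +1} for i = 1, …, N, λ ≥ 0, and α > 0, for every w ∈ ℝ^m one has 0 ≤ f̂_α(w) − f̂(w) ≤ α/2, where f̂_α is the smoothed SVM objective and f̂(w) = (λ/2)‖w‖² + (1/N) Σ_{i=1}^N max(0, 1 − y_i wᵀx_i) is the unsmoothed soft-margin SVM objective. -/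
open RealInnerProductSpace

/-- The smoothed hinge lies between the hinge and the hinge plus `1 / 2`. -/
theorem smoothed_hinge_bounds (u : ℝ) :
    max 0 u ≤ (1/2) * (u + Real.sqrt (1 + u^2)) ∧
      (1/2) * (u + Real.sqrt (1 + u^2)) ≤ max 0 u + 1 / 2 := by
  have hlow : |u| ≤ Real.sqrt (1 + u^2) := Real.abs_le_sqrt (by linarith)
  have hup : Real.sqrt (1 + u^2) ≤ 1 + |u| :=
    Real.sqrt_le_iff.mpr ⟨by positivity, by nlinarith [abs_nonneg u, sq_abs u]⟩
  rcases le_total 0 u with h | h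
  · rw [abs_of_nonneg h] at hlow hup
    rw [max_eq_right h]
    constructor <;> linarith
  · rw [abs_of_nonpos h] at hlow hup
    rw [max_eq_left h]
    constructor <;> linarith

/-- The smoothed hinge rescaled by `α` lies between the hinge and the hinge plus `α / 2`. -/
theorem scaled_smoothed_hinge_bounds {α : ℝ} (hα : 0 < α) (t : ℝ) :
    max 0 t ≤ α * ((1/2) * (t / α + Real.sqrt (1 + (t / α)^2))) ∧
      α * ((1/2) * (t / α + Real.sqrt (1 + (t / α)^2))) ≤ max 0 t + α / 2 := by
  obtain ⟨hlow, hup⟩ := smoothed_hinge_bounds (t / α)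
  have hmax : α * max 0 (t / α) = max 0 t := by
    rw [mul_max_of_nonneg _ _ hα.le, mul_zero, mul_div_cancel₀ _ hα.ne']
  have hlow' := mul_le_mul_of_nonneg_left hlow hα.le
  have hup' := mul_le_mul_of_nonneg_left hup hα.le
  rw [mul_add α (max _ _), hmax] at hup'
  rw [hmax] at hlow'
  exact ⟨hlow', by linarith⟩

/-- For every w, 0 ≤ f̂_α(w) − f̂(w) ≤ α/2, where f̂_α is the smoothed SVM
objective and f̂ is the unsmoothed soft-margin SVM objective. -/
theorem smoothed_svm_objective_close_to_unsmoothed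
    (m N : ℕ) (hN : 0 < N)
    (x : Fin N → EuclideanSpace ℝ (Fin m)) (y : Fin N → ℝ)
    (hy : ∀ i, y i = 1 ∨ y i = -1)
    (lam α : ℝ) (hlam : 0 ≤ lam) (hα : 0 < α)
    (ψ : ℝ → ℝ) (hψ : ∀ u : ℝ, ψ u = (1/2) * (u + Real.sqrt (1 + u^2)))
    (fα f : EuclideanSpace ℝ (Fin m) → ℝ)
    (hfα : ∀ w, fα w = lam / 2 * ‖w‖^2
        + (1/(N:ℝ)) * ∑ i, α * ψ ((1 - y i * ⟪w, x i⟫) / α))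
    (hf : ∀ w, f w = lam / 2 * ‖w‖^2
        + (1/(N:ℝ)) * ∑ i, max 0 (1 - y i * ⟪w, x i⟫))
    (w : EuclideanSpace ℝ (Fin m)) :
    0 ≤ fα w - f w ∧ fα w - f w ≤ α / 2 := by
  have hN' : (0 : ℝ) < N := Nat.cast_pos.mpr hN
  have hdiff : fα w - f w = (1/(N:ℝ)) *
      ∑ i, (α * ψ ((1 - y i * ⟪w, x i⟫) / α) - max 0 (1 - y i * ⟪w, x i⟫)) := by
    rw [hfα, hf, Finset.sum_sub_distrib]
    ring
  have hbounds := fun i => scaled_smoothed_hinge_bounds hα (1 - y i * ⟪w, x i⟫)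
  simp only [← hψ] at hbounds
  rw [hdiff]
  constructor
  · exact mul_nonneg (by positivity)
      (Finset.sum_nonneg fun i _ => sub_nonneg.mpr (hbounds i).1)
  · have hsum : ∑ i, (α * ψ ((1 - y i * ⟪w, x i⟫) / α) - max 0 (1 - y i * ⟪w, x i⟫))
        ≤ ∑ _i : Fin N, α / 2 :=
      Finset.sum_le_sum fun i _ => sub_le_iff_le_add'.mpr (hbounds i).2
    rw [Finset.sum_const, Finset.card_univ, Fintype.card_fin, nsmul_eq_mul] at hsum
    rw [one_div_mul_eq_div, div_le_iff₀ hN']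
    linarith
end

section
/- Fix data points (x_i, y_i) ∈ ℝ^m × {−1, +1}, i = 1, …, N, λ > 0, and a point w ∈ ℝ^m. Then as α → ∞: (i) the gradient ∇f̂_α(w) = λw − (1/N) Σ_{i=1}^N ψ'((1 − y_i wᵀx_i)/α)·y_i x_i converges to λw − (1/(2N)) Σ_{i=1}^N y_i x_i; (ii) the Hessian Hess f̂_α(w) = λI + (1/(Nα)) Σ_{i=1}^N ψ''((1 − y_i wᵀx_i)/α)·x_i x_iᵀ converges to λI; and (iii) the Newton iterate w − (Hess f̂_α(w))^{-1} ∇f̂_α(w) converges to (1/(2Nλ)) Σ_{i=1}^N y_i x_i. -/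
open Filter

theorem tendsto_const_div_atTop_zero (c : ℝ) :
    Tendsto (fun α : ℝ => c / α) atTop (nhds 0) :=
  tendsto_const_nhds.div_atTop tendsto_id

theorem continuous_smoothedHinge_deriv :
    Continuous fun u : ℝ => (1/2) * (1 + u / Real.sqrt (1 + u^2)) := by
  have h : ∀ u : ℝ, Real.sqrt (1 + u^2) ≠ 0 := fun u => (Real.sqrt_pos.2 (by positivity)).ne'
  exact continuous_const.mul
    (continuous_const.add (continuous_id.div (by fun_prop) h))

theorem continuous_smoothedHinge_deriv_two :
    Continuous fun u : ℝ => (1/2) * (1 + u^2) ^ (-(3:ℝ)/2) := by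
  have h : ∀ u : ℝ, 1 + u^2 ≠ 0 ∨ 0 ≤ -(3:ℝ)/2 := fun u => Or.inl (by positivity)
  exact continuous_const.mul
    ((show Continuous fun u : ℝ => 1 + u^2 by fun_prop).rpow_const h)

/-- Fix data, λ > 0 and w.  As α → ∞:
(i) the gradient ∇f̂_α(w) = λw − (1/N)Σᵢ ψ'((1 − yᵢwᵀxᵢ)/α)·yᵢxᵢ converges to
λw − (1/(2N))Σᵢ yᵢxᵢ;
(ii) the Hessian λI + (1/(Nα))Σᵢ ψ''((1 − yᵢwᵀxᵢ)/α)·xᵢxᵢᵀ converges to λI;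
(iii) the Newton iterate w − (Hess f̂_α(w))⁻¹∇f̂_α(w) converges to (1/(2Nλ))Σᵢ yᵢxᵢ. -/
theorem smoothed_svm_opening_newton_limit
    (m N : ℕ) (hN : 0 < N)
    (x : Fin N → Fin m → ℝ) (y : Fin N → ℝ)
    (hy : ∀ i, y i = 1 ∨ y i = -1)
    (lam : ℝ) (hlam : 0 < lam) (w : Fin m → ℝ)
    (ψ' ψ'' : ℝ → ℝ)
    (hψ' : ∀ u : ℝ, ψ' u = (1/2) * (1 + u / Real.sqrt (1 + u^2)))
    (hψ'' : ∀ u : ℝ, ψ'' u = (1/2) * (1 + u^2) ^ (-(3:ℝ)/2))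
    (grad : ℝ → (Fin m → ℝ))
    (hgrad : ∀ α : ℝ, grad α = lam • w -
        (1/(N:ℝ)) • ∑ i, ψ' ((1 - y i * ∑ k, w k * x i k) / α) • (y i • x i))
    (Hess : ℝ → Matrix (Fin m) (Fin m) ℝ)
    (hHess : ∀ α : ℝ, Hess α = lam • (1 : Matrix (Fin m) (Fin m) ℝ)
        + (1/((N:ℝ) * α)) •
          ∑ i, ψ'' ((1 - y i * ∑ k, w k * x i k) / α) • Matrix.vecMulVec (x i) (x i)) :
    Tendsto grad atTop (nhds (lam • w - (1/(2*(N:ℝ))) • ∑ i, y i • x i)) ∧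
    Tendsto Hess atTop (nhds (lam • (1 : Matrix (Fin m) (Fin m) ℝ))) ∧
    Tendsto (fun α : ℝ => w - (Hess α)⁻¹.mulVec (grad α)) atTop
      (nhds ((1/(2*(N:ℝ)*lam)) • ∑ i, y i • x i)) := by
  have hNR : (N:ℝ) ≠ 0 := by exact_mod_cast hN.ne'
  have hG : Tendsto grad atTop (nhds (lam • w - (1/(2*(N:ℝ))) • ∑ i, y i • x i)) := by
    have hlim : lam • w - (1/(2*(N:ℝ))) • ∑ i, y i • x i
        = lam • w - (1/(N:ℝ)) • ∑ i, (1/2 : ℝ) • (y i • x i) := by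
      rw [← Finset.smul_sum, smul_smul]
      congr 2
      field_simp
    rw [hlim, funext hgrad]
    refine tendsto_const_nhds.sub (tendsto_const_nhds.smul (tendsto_finsetSum _ fun i _ => ?_))
    refine Tendsto.smul ?_ tendsto_const_nhds
    have h := (continuous_smoothedHinge_deriv.tendsto 0).comp
      (tendsto_const_div_atTop_zero (1 - y i * ∑ k, w k * x i k))
    simpa [funext hψ', Function.comp_def] using h
  have hH : Tendsto Hess atTop (nhds (lam • (1 : Matrix (Fin m) (Fin m) ℝ))) := by
    have hlim : lam • (1 : Matrix (Fin m) (Fin m) ℝ) = lam • (1 : Matrix (Fin m) (Fin m) ℝ)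
        + (0:ℝ) • ∑ i, (1/2 : ℝ) • Matrix.vecMulVec (x i) (x i) := by simp
    rw [hlim, funext hHess]
    refine tendsto_const_nhds.add (Tendsto.smul ?_ (tendsto_finsetSum _ fun i _ => ?_))
    · simpa only [div_div] using tendsto_const_div_atTop_zero (1/(N:ℝ))
    refine Tendsto.smul ?_ tendsto_const_nhds
    have h := (continuous_smoothedHinge_deriv_two.tendsto 0).comp
      (tendsto_const_div_atTop_zero (1 - y i * ∑ k, w k * x i k))
    simpa [funext hψ'', Function.comp_def] using h
  refine ⟨hG, hH, ?_⟩
  have hdet : (lam • (1 : Matrix (Fin m) (Fin m) ℝ)).det ≠ 0 := by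
    simp [hlam.ne']
  have hinv : (lam • (1 : Matrix (Fin m) (Fin m) ℝ))⁻¹ = lam⁻¹ • 1 :=
    Matrix.inv_eq_right_inv (by simp [smul_smul, hlam.ne'])
  have hI := (continuousAt_matrix_inv _ (Ring.inverse_eq_inv' (G₀ := ℝ) ▸ continuousAt_inv₀ hdet)).tendsto.comp hH
  have hmul : Continuous fun p : Matrix (Fin m) (Fin m) ℝ × (Fin m → ℝ) => p.1.mulVec p.2 :=
    continuous_fst.matrix_mulVec continuous_snd
  have h := (tendsto_const_nhds (x := w)).sub ((hmul.tendsto _).comp (hI.prodMk_nhds hG))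
  convert! h using 2
  rw [hinv, Matrix.smul_mulVec, Matrix.one_mulVec, smul_sub, smul_smul, smul_smul,
    inv_mul_cancel₀ hlam.ne', one_smul, sub_sub_cancel]
  congr 1
  field_simp
end
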